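/- Let m ≥ 1, let [m] be partitioned into (possibly empty) sets U₂, U₁^S, U₁^S̄, and let η, η_S, η_S̄ > 0. Define Ψ on the nonnegative orthant of ℝ^m by Ψ(y) = Σ_{k∈U₂} (−√(y_k))/η + Σ_{k∈U₁^S} (−√(y_k))/η_S + Σ_{k∈U₁^S̄} y_k·log(y_k)/η_S̄ (with 0·log 0 = 0). Let Y ∈ ℝ^m satisfy Y_i > 0 for all i and Σ_i Y_i = 1, and let L' ∈ ℝ^m satisfy L'_i · max{η, η_S, η_S̄} ≥ −1/4 for every i ∈ [m]. Define the Bregman divergence B_Ψ(a,Y) = Ψ(a) − Ψ(Y) − ⟨∇Ψ(Y), a − Y⟩. Then any minimizer W of the map a ↦ ⟨a, L'⟩ + B_Ψ(a,Y) over the nonnegative orthant satisfies W_i ≤ 4·Y_i for every i ∈ [m]. -/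

import Mathlib

open scoped BigOperators

/-- The hybrid potential function `Ψ` on the nonnegative orthant of `ℝ^m`:
Tsallis entropy (with rates `η` and `ηS`) on the coordinates in `U₂` and `U₁S`,
and negative entropy (with rate `ηSb`) on the coordinates in `U₁Sb`.
(Note `Real.log 0 = 0` in Mathlib, so `0 · log 0 = 0` holds definitionally.) -/
noncomputable def hybridPsi {m : ℕ} (U₂ U₁S U₁Sb : Finset (Fin m)) (η ηS ηSb : ℝ)
    (y : Fin m → ℝ) : ℝ :=
  (∑ k ∈ U₂, -Real.sqrt (y k) / η) + (∑ k ∈ U₁S, -Real.sqrt (y k) / ηS) +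
    ∑ k ∈ U₁Sb, y k * Real.log (y k) / ηSb

/-- The gradient of `hybridPsi` at an interior point `Y` of the orthant. -/
noncomputable def hybridPsiGrad {m : ℕ} (U₂ U₁S U₁Sb : Finset (Fin m)) (η ηS ηSb : ℝ)
    (Y : Fin m → ℝ) (i : Fin m) : ℝ :=
  if i ∈ U₂ then -1 / (2 * η * Real.sqrt (Y i))
  else if i ∈ U₁S then -1 / (2 * ηS * Real.sqrt (Y i))
  else (Real.log (Y i) + 1) / ηSb

/-- The coordinate function of `hybridPsi` at index `i`. -/
noncomputable def hybridPsiCoord {m : ℕ} (U₂ U₁S : Finset (Fin m)) (η ηS ηSb : ℝ)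
    (i : Fin m) (t : ℝ) : ℝ :=
  if i ∈ U₂ then -Real.sqrt t / η
  else if i ∈ U₁S then -Real.sqrt t / ηS
  else t * Real.log t / ηSb

theorem hybridPsi_eq_sum_coord {m : ℕ} {U₂ U₁S U₁Sb : Finset (Fin m)}
    (hd1 : Disjoint U₂ U₁S) (hd2 : Disjoint U₂ U₁Sb) (hd3 : Disjoint U₁S U₁Sb)
    (hcover : U₂ ∪ U₁S ∪ U₁Sb = Finset.univ) (η ηS ηSb : ℝ) (y : Fin m → ℝ) :
    hybridPsi U₂ U₁S U₁Sb η ηS ηSb y = ∑ i, hybridPsiCoord U₂ U₁S η ηS ηSb i (y i) := by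
  rw [← hcover, Finset.sum_union (Finset.disjoint_union_left.2 ⟨hd2, hd3⟩),
    Finset.sum_union hd1, hybridPsi]
  congr 1
  · congr 1
    · exact Finset.sum_congr rfl fun i hi => by simp [hybridPsiCoord, hi]
    · exact Finset.sum_congr rfl fun i hi => by
        simp [hybridPsiCoord, hi, Finset.disjoint_right.1 hd1 hi]
  · exact Finset.sum_congr rfl fun i hi => by
      simp [hybridPsiCoord, Finset.disjoint_right.1 hd2 hi, Finset.disjoint_right.1 hd3 hi]

/-- A minimizer of a separable sum over the nonnegative orthant minimizes each summand. -/
theorem isMinOn_coord_of_isMinOn_sum {ι : Type*} [Fintype ι] {f : ι → ℝ → ℝ} {W : ι → ℝ}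
    (hW : ∀ i, 0 ≤ W i) (hmin : IsMinOn (fun a : ι → ℝ => ∑ i, f i (a i)) {a | ∀ i, 0 ≤ a i} W)
    (i : ι) : IsMinOn (f i) (Set.Ici 0) (W i) := by
  classical
  intro t ht
  have hmem : Function.update W i t ∈ {a : ι → ℝ | ∀ i, 0 ≤ a i} := by
    intro j
    rcases eq_or_ne j i with rfl | hj
    · simpa using ht
    · simpa [hj] using hW j
  have h : ∑ j, f j (W j) ≤ ∑ j, f j (Function.update W i t j) := hmin hmem
  have hrest : ∑ j ∈ Finset.univ.erase i, f j (Function.update W i t j) =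
      ∑ j ∈ Finset.univ.erase i, f j (W j) :=
    Finset.sum_congr rfl fun j hj => by rw [Function.update_of_ne (Finset.ne_of_mem_erase hj)]
  rw [← Finset.add_sum_erase _ _ (Finset.mem_univ i),
    ← Finset.add_sum_erase _ (fun j => f j (Function.update W i t j)) (Finset.mem_univ i),
    hrest, Function.update_self] at h
  exact le_of_add_le_add_right h

/-- First-order condition at a positive minimizer of a linearly perturbed function on `[0, ∞)`. -/
theorem add_deriv_sub_eq_zero_of_isMinOn {ψ : ℝ → ℝ} {l c g y w d : ℝ} (hw : 0 < w)
    (hψ : HasDerivAt ψ d w)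
    (hmin : IsMinOn (fun t => t * l + (ψ t - c - g * (t - y))) (Set.Ici 0) w) :
    l + (d - g) = 0 := by
  have hderiv : HasDerivAt (fun t => t * l + (ψ t - c - g * (t - y))) (l + (d - g)) w := by
    have h := ((hasDerivAt_id w).mul_const l).add
      ((hψ.sub_const c).sub (((hasDerivAt_id w).sub_const y).const_mul g))
    rw [one_mul, mul_one] at h
    exact h
  exact (hmin.isLocalMin (Ici_mem_nhds hw)).hasDerivAt_eq_zero hderiv

/-- The Tsallis mirror step grows a coordinate in `(0, 1]` by at most a factor `4`. -/
theorem le_four_mul_of_isMinOn_sqrt {e l c y w : ℝ} (he : 0 < e) (hy : 0 < y) (hy1 : y ≤ 1)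
    (hw : 0 ≤ w) (hl : -(1 / 4) ≤ l * e)
    (hmin : IsMinOn (fun t => t * l + (-Real.sqrt t / e - c -
      -1 / (2 * e * Real.sqrt y) * (t - y))) (Set.Ici 0) w) :
    w ≤ 4 * y := by
  rcases hw.eq_or_lt with rfl | hw
  · linarith
  have h := add_deriv_sub_eq_zero_of_isMinOn hw
    ((Real.hasDerivAt_sqrt hw.ne').neg.div_const e) hmin
  have hsw := Real.sqrt_pos.2 hw
  have hsy := Real.sqrt_pos.2 hy
  have hsy1 : Real.sqrt y ≤ 1 := Real.sqrt_le_one.2 hy1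
  have hle : Real.sqrt w ≤ 2 * Real.sqrt y := by
    field_simp at h
    have hb : -(1 / 4) * (Real.sqrt w * Real.sqrt y) ≤ l * e * (Real.sqrt w * Real.sqrt y) :=
      mul_le_mul_of_nonneg_right hl (by positivity)
    have hc : Real.sqrt w * Real.sqrt y ≤ Real.sqrt w := mul_le_of_le_one_right hsw.le hsy1
    nlinarith
  calc w = Real.sqrt w ^ 2 := (Real.sq_sqrt hw.le).symm
    _ ≤ (2 * Real.sqrt y) ^ 2 := by gcongr
    _ = 4 * y := by rw [mul_pow, Real.sq_sqrt hy.le]; norm_num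

/-- The negative-entropy mirror step grows a coordinate by at most a factor `4`. -/
theorem le_four_mul_of_isMinOn_mul_log {e l c y w : ℝ} (he : 0 < e) (hy : 0 < y)
    (hw : 0 ≤ w) (hl : -(1 / 4) ≤ l * e)
    (hmin : IsMinOn (fun t => t * l + (t * Real.log t / e - c -
      (Real.log y + 1) / e * (t - y))) (Set.Ici 0) w) :
    w ≤ 4 * y := by
  rcases hw.eq_or_lt with rfl | hw
  · linarith
  have h := add_deriv_sub_eq_zero_of_isMinOn hw
    ((Real.hasDerivAt_mul_log hw.ne').div_const e) hmin
  field_simp at h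
  have hlog4 : 1 - (4 : ℝ)⁻¹ ≤ Real.log 4 := Real.one_sub_inv_le_log_of_pos (by norm_num)
  rw [← Real.log_le_log_iff hw (by positivity), Real.log_mul (by norm_num) hy.ne']
  linarith

theorem neg_quarter_le_mul_of_le {l e M : ℝ} (he : 0 < e) (heM : e ≤ M)
    (h : -(1 / 4) ≤ l * M) : -(1 / 4) ≤ l * e := by
  rcases le_total 0 l with hl | hl
  · have := mul_nonneg hl he.le
    linarith
  · exact h.trans (mul_le_mul_of_nonpos_left heM hl)

/-- Let `[m]` be partitioned into `U₂, U₁S, U₁Sb` and let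
`η, ηS, ηSb > 0`.  Let `Y` be a strictly positive probability vector and let `L'`
satisfy `L'_i · max{η, ηS, ηSb} ≥ -1/4` for all `i`.  Then any minimizer `W`, over the
nonnegative orthant, of `a ↦ ⟨a, L'⟩ + B_Ψ(a, Y)` (where `B_Ψ(a,Y) = Ψ(a) - Ψ(Y) -
⟨∇Ψ(Y), a - Y⟩` is the Bregman divergence of the hybrid potential `Ψ`) satisfies
`W_i ≤ 4·Y_i` for every `i`. -/
theorem hybrid_mirror_descent_minimizer_bound {m : ℕ} (hm : 1 ≤ m)
    (U₂ U₁S U₁Sb : Finset (Fin m))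
    (hd1 : Disjoint U₂ U₁S) (hd2 : Disjoint U₂ U₁Sb) (hd3 : Disjoint U₁S U₁Sb)
    (hcover : U₂ ∪ U₁S ∪ U₁Sb = Finset.univ)
    (η ηS ηSb : ℝ) (hη : 0 < η) (hηS : 0 < ηS) (hηSb : 0 < ηSb)
    (Y : Fin m → ℝ) (hYpos : ∀ i, 0 < Y i) (hYsum : ∑ i, Y i = 1)
    (L : Fin m → ℝ) (hL : ∀ i, -(1 / 4) ≤ L i * max η (max ηS ηSb))
    (W : Fin m → ℝ) (hWmem : W ∈ {a : Fin m → ℝ | ∀ i, 0 ≤ a i})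
    (hWmin : IsMinOn
      (fun a : Fin m → ℝ => (∑ i, a i * L i) +
        (hybridPsi U₂ U₁S U₁Sb η ηS ηSb a - hybridPsi U₂ U₁S U₁Sb η ηS ηSb Y -
          ∑ i, hybridPsiGrad U₂ U₁S U₁Sb η ηS ηSb Y i * (a i - Y i)))
      {a : Fin m → ℝ | ∀ i, 0 ≤ a i} W) :
    ∀ i, W i ≤ 4 * Y i := by
  have hsep : IsMinOn (fun a : Fin m → ℝ => ∑ i, (a i * L i +
      (hybridPsiCoord U₂ U₁S η ηS ηSb i (a i) - hybridPsiCoord U₂ U₁S η ηS ηSb i (Y i) -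
        hybridPsiGrad U₂ U₁S U₁Sb η ηS ηSb Y i * (a i - Y i)))) {a | ∀ i, 0 ≤ a i} W := by
    simpa only [hybridPsi_eq_sum_coord hd1 hd2 hd3 hcover, ← Finset.sum_sub_distrib,
      ← Finset.sum_add_distrib] using hWmin
  intro i
  have hmin := isMinOn_coord_of_isMinOn_sum (f := fun i t => t * L i +
    (hybridPsiCoord U₂ U₁S η ηS ηSb i t - hybridPsiCoord U₂ U₁S η ηS ηSb i (Y i) -
      hybridPsiGrad U₂ U₁S U₁Sb η ηS ηSb Y i * (t - Y i))) hWmem hsep i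
  have hY1 : Y i ≤ 1 :=
    hYsum ▸ Finset.single_le_sum (fun j _ => (hYpos j).le) (Finset.mem_univ i)
  by_cases h₂ : i ∈ U₂
  · simp only [hybridPsiCoord, hybridPsiGrad, h₂, if_true] at hmin
    exact le_four_mul_of_isMinOn_sqrt hη (hYpos i) hY1 (hWmem i)
      (neg_quarter_le_mul_of_le hη (le_max_left _ _) (hL i)) hmin
  by_cases h₁ : i ∈ U₁S
  · simp only [hybridPsiCoord, hybridPsiGrad, h₂, h₁, if_true, if_false] at hmin
    exact le_four_mul_of_isMinOn_sqrt hηS (hYpos i) hY1 (hWmem i)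
      (neg_quarter_le_mul_of_le hηS ((le_max_left _ _).trans (le_max_right _ _)) (hL i)) hmin
  · simp only [hybridPsiCoord, hybridPsiGrad, h₂, h₁, if_false] at hmin
    exact le_four_mul_of_isMinOn_mul_log hηSb (hYpos i) (hWmem i)
      (neg_quarter_le_mul_of_le hηSb ((le_max_right _ _).trans (le_max_right _ _)) (hL i)) hmin
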